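/- arXiv:2006.05271 — 6 statements merged into one kernel-verified Lean document; each statement's English description precedes it below -/
import Mathlib

section
/- Let D• be a cochain complex of projective k-modules which is bounded above (D^j = 0 for all sufficiently large j) and such that H^j(D•) is a projective k-module for every j. Then for every cochain complex C• of k-modules and every integer n, the natural map ⊕_{i+j=n} H^i(C•) ⊗_k H^j(D•) → H^n(C• ⊗_k D•) is an isomorphism. -/
open TensorProduct

set_option maxHeartbeats 1000000

namespace Kunneth

variable (k : Type*) [CommRing k]

section Complex

variable (X : ℤ → Type*) [∀ n, AddCommGroup (X n)] [∀ n, Module k (X n)]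
variable (dX : ∀ n m : ℤ, X n →ₗ[k] X m)

/-- The `n`-cocycles of the cochain complex `(X, dX)`. -/
abbrev cocycles (n : ℤ) : Submodule k (X n) := LinearMap.ker (dX n (n + 1))

/-- The coboundaries, viewed as a submodule of the cocycles. -/
abbrev cobdriesIn (n : ℤ) : Submodule k (cocycles k X dX n) :=
  (LinearMap.range (dX (n - 1) n)).comap (cocycles k X dX n).subtype

/-- The `n`-th cohomology of the cochain complex `(X, dX)`. -/
abbrev cohomology (n : ℤ) : Type _ := cocycles k X dX n ⧸ cobdriesIn k X dX n

/-- The cohomology class of a cocycle-valued linear map. -/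
noncomputable def homClass {M : Type*} [AddCommGroup M] [Module k M] (n : ℤ)
    (f : M →ₗ[k] X n) (hf : ∀ x, f x ∈ cocycles k X dX n) :
    M →ₗ[k] cohomology k X dX n :=
  (cobdriesIn k X dX n).mkQ.comp (LinearMap.codRestrict _ f hf)

end Complex

section Tensor

variable (C : ℤ → Type*) [∀ n, AddCommGroup (C n)] [∀ n, Module k (C n)]
variable (dC : ∀ n m : ℤ, C n →ₗ[k] C m)
variable (D : ℤ → Type*) [∀ n, AddCommGroup (D n)] [∀ n, Module k (D n)]
variable (dD : ∀ n m : ℤ, D n →ₗ[k] D m)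

/-- The pairs `(i, j)` with `i + j = n`. -/
abbrev Idx (n : ℤ) : Type := {p : ℤ × ℤ // p.1 + p.2 = n}

/-- The degree `n` term `⊕_{i+j=n} C^i ⊗ D^j` of the total tensor complex `C ⊗ D`. -/
abbrev tensorCplx (n : ℤ) : Type _ :=
  DirectSum (Idx n) fun p => C p.1.1 ⊗[k] D p.1.2

/-- Inclusion of `C^{q₁} ⊗ D^{q₂}` as the `q`-summand of the total complex (or `0` if
`q₁ + q₂ ≠ m`). -/
noncomputable def lofIf (q : ℤ × ℤ) (m : ℤ) :
    (C q.1 ⊗[k] D q.2) →ₗ[k] tensorCplx k C D m :=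
  if h : q.1 + q.2 = m then
    DirectSum.lof k (Idx m) (fun p => C p.1.1 ⊗[k] D p.1.2) ⟨q, h⟩
  else 0

/-- The differential of the total tensor complex: on the summand `C^i ⊗ D^j` it is
`dC ⊗ 1 + (−1)^i (1 ⊗ dD)` (the usual sign convention). -/
noncomputable def tensorD (n m : ℤ) : tensorCplx k C D n →ₗ[k] tensorCplx k C D m :=
  DirectSum.toModule k (Idx n) (tensorCplx k C D m) fun p =>
    (lofIf k C D (p.1.1 + 1, p.1.2) m).comp
        (TensorProduct.map (dC p.1.1 (p.1.1 + 1)) LinearMap.id)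
      + ((p.1.1.negOnePow : ℤ) •
        (lofIf k C D (p.1.1, p.1.2 + 1) m).comp
          (TensorProduct.map LinearMap.id (dD p.1.2 (p.1.2 + 1))))

/-- The tensor product of two cocycles, as an element of the total tensor complex. -/
noncomputable def cocycleTensor (n : ℤ) (p : Idx n) :
    (cocycles k C dC p.1.1 ⊗[k] cocycles k D dD p.1.2) →ₗ[k] tensorCplx k C D n :=
  (DirectSum.lof k (Idx n) (fun p => C p.1.1 ⊗[k] D p.1.2) p).comp
    (TensorProduct.map (cocycles k C dC p.1.1).subtype (cocycles k D dD p.1.2).subtype)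

/-- The tensor product of two cocycles is a cocycle of the total tensor complex. -/
theorem cocycleTensor_mem (n : ℤ) (p : Idx n)
    (x : cocycles k C dC p.1.1 ⊗[k] cocycles k D dD p.1.2) :
    cocycleTensor k C dC D dD n p x ∈
      cocycles k (tensorCplx k C D) (tensorD k C dC D dD) n := by
  rw [LinearMap.mem_ker]
  induction x using TensorProduct.induction_on with
  | zero => simp
  | tmul c d =>
      have hc : dC p.1.1 (p.1.1 + 1) c.1 = 0 := LinearMap.mem_ker.mp c.2
      have hd : dD p.1.2 (p.1.2 + 1) d.1 = 0 := LinearMap.mem_ker.mp d.2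
      simp [cocycleTensor, tensorD, DirectSum.toModule_lof, hc, hd]
  | add a b ha hb => rw [map_add, map_add, ha, hb, add_zero]

/-- The tensor product of two cocycles, as a cohomology class of the total complex. -/
noncomputable def cocycleTensorH (n : ℤ) (p : Idx n) :
    (cocycles k C dC p.1.1 ⊗[k] cocycles k D dD p.1.2) →ₗ[k]
      cohomology k (tensorCplx k C D) (tensorD k C dC D dD) n :=
  homClass k (tensorCplx k C D) (tensorD k C dC D dD) n
    (cocycleTensor k C dC D dD n p) (cocycleTensor_mem k C dC D dD n p)

theorem right_welldef (n : ℤ) (p : Idx n) :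
    cobdriesIn k D dD p.1.2 ≤
      LinearMap.ker (TensorProduct.curry (cocycleTensorH k C dC D dD n p)).flip := by
  obtain ⟨⟨i, j⟩, hij⟩ := p
  intro d hd
  obtain ⟨y, hy⟩ := Submodule.mem_comap.mp hd
  rw [LinearMap.mem_ker]
  refine LinearMap.ext fun c => ?_
  have hj : j - 1 + 1 = j := by omega
  have h' : i + (j - 1) = n - 1 := by omega
  have hc : dC i (i + 1) c.1 = 0 := LinearMap.mem_ker.mp c.2
  have hmem : cocycleTensor k C dC D dD n ⟨(i, j), hij⟩ (c ⊗ₜ d) ∈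
      LinearMap.range (tensorD k C dC D dD (n - 1) n) := by
    refine ⟨(Int.negOnePow i : ℤ) •
        DirectSum.lof k (Idx (n - 1)) (fun q => C q.1.1 ⊗[k] D q.1.2)
          ⟨(i, j - 1), h'⟩ (c.1 ⊗ₜ y), ?_⟩
    rw [LinearMap.map_smul_of_tower]
    simp only [tensorD, DirectSum.toModule_lof, LinearMap.add_apply, LinearMap.comp_apply,
      LinearMap.smul_apply, TensorProduct.map_tmul, LinearMap.id_apply, hc,
      TensorProduct.zero_tmul, map_zero, zero_add, smul_smul, ← Units.val_mul,
      Int.units_mul_self, Units.val_one, one_smul]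
    rw [hj, hy]
    simp only [lofIf, cocycleTensor, LinearMap.comp_apply, TensorProduct.map_tmul,
      Submodule.coe_subtype]
    rw [dif_pos hij]
  simp only [LinearMap.flip_apply, TensorProduct.curry_apply, LinearMap.zero_apply]
  simp only [cocycleTensorH, homClass, LinearMap.comp_apply, Submodule.mkQ_apply]
  rw [Submodule.Quotient.mk_eq_zero]
  simpa only [Submodule.mem_comap, Submodule.coe_subtype, LinearMap.codRestrict_apply]
    using hmem

/-- The tensor product of a cocycle of `C` with a cohomology class of `D`. -/
noncomputable def cocycleClassTensor (n : ℤ) (p : Idx n) :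
    cohomology k D dD p.1.2 →ₗ[k]
      (cocycles k C dC p.1.1 →ₗ[k]
        cohomology k (tensorCplx k C D) (tensorD k C dC D dD) n) :=
  Submodule.liftQ _ (TensorProduct.curry (cocycleTensorH k C dC D dD n p)).flip
    (right_welldef k C dC D dD n p)

theorem left_welldef (n : ℤ) (p : Idx n) :
    cobdriesIn k C dC p.1.1 ≤
      LinearMap.ker (cocycleClassTensor k C dC D dD n p).flip := by
  obtain ⟨⟨i, j⟩, hij⟩ := p
  intro b hb
  obtain ⟨y, hy⟩ := Submodule.mem_comap.mp hb
  rw [LinearMap.mem_ker]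
  refine LinearMap.ext fun q => ?_
  obtain ⟨d, rfl⟩ := Submodule.Quotient.mk_surjective _ q
  have hi : i - 1 + 1 = i := by omega
  have h' : (i - 1) + j = n - 1 := by omega
  have hd : dD j (j + 1) d.1 = 0 := LinearMap.mem_ker.mp d.2
  have hmem : cocycleTensor k C dC D dD n ⟨(i, j), hij⟩ (b ⊗ₜ d) ∈
      LinearMap.range (tensorD k C dC D dD (n - 1) n) := by
    refine ⟨DirectSum.lof k (Idx (n - 1)) (fun q => C q.1.1 ⊗[k] D q.1.2)
        ⟨(i - 1, j), h'⟩ (y ⊗ₜ d.1), ?_⟩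
    simp only [tensorD, DirectSum.toModule_lof, LinearMap.add_apply, LinearMap.comp_apply,
      LinearMap.smul_apply, TensorProduct.map_tmul, LinearMap.id_apply, hd,
      TensorProduct.tmul_zero, map_zero, smul_zero, add_zero]
    rw [hi, hy]
    simp only [lofIf, cocycleTensor, LinearMap.comp_apply, TensorProduct.map_tmul,
      Submodule.coe_subtype]
    rw [dif_pos hij]
  simp only [LinearMap.flip_apply, LinearMap.zero_apply]
  rw [cocycleClassTensor, Submodule.liftQ_apply]
  simp only [LinearMap.flip_apply, TensorProduct.curry_apply]
  simp only [cocycleTensorH, homClass, LinearMap.comp_apply, Submodule.mkQ_apply]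
  rw [Submodule.Quotient.mk_eq_zero]
  simpa only [Submodule.mem_comap, Submodule.coe_subtype, LinearMap.codRestrict_apply]
    using hmem

/-- The natural map `H^i(C) ⊗ H^j(D) → H^n(C ⊗ D)` (for `i + j = n`) induced by the
tensor product of cocycles. -/
noncomputable def kunnethPiece (n : ℤ) (p : Idx n) :
    (cohomology k C dC p.1.1 ⊗[k] cohomology k D dD p.1.2) →ₗ[k]
      cohomology k (tensorCplx k C D) (tensorD k C dC D dD) n :=
  TensorProduct.lift
    (Submodule.liftQ _ (cocycleClassTensor k C dC D dD n p).flip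
      (left_welldef k C dC D dD n p))

/-- The natural map `⊕_{i+j=n} H^i(C) ⊗ H^j(D) → H^n(C ⊗ D)` induced by the tensor
product of cocycles. -/
noncomputable def kunnethMap (n : ℤ) :
    (DirectSum (Idx n) fun p => cohomology k C dC p.1.1 ⊗[k] cohomology k D dD p.1.2) →ₗ[k]
      cohomology k (tensorCplx k C D) (tensorD k C dC D dD) n :=
  DirectSum.toModule k (Idx n) _ fun p => kunnethPiece k C dC D dD n p

end Tensor

end Kunneth

namespace Kunneth

section Contraction

/-- If `g ∘ f = 0` and the middle term, the image of `g` and the homology of `f, g` are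
projective, then so is the image of `f`. -/
theorem projective_range_of_comp_eq_zero {k A B E : Type*} [CommRing k]
    [AddCommGroup A] [Module k A] [AddCommGroup B] [Module k B] [AddCommGroup E] [Module k E]
    (f : A →ₗ[k] B) (g : B →ₗ[k] E) (hgf : g.comp f = 0)
    [Module.Projective k B] [Module.Projective k (LinearMap.range g)]
    [Module.Projective k
      (LinearMap.ker g ⧸ (LinearMap.range f).comap (LinearMap.ker g).subtype)] :
    Module.Projective k (LinearMap.range f) := by
  set H := (LinearMap.range f).comap (LinearMap.ker g).subtype
  obtain ⟨σ, hσ⟩ := g.rangeRestrict.exists_rightInverse_of_surjective g.range_rangeRestrict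
  obtain ⟨ι, hι⟩ := H.mkQ.exists_rightInverse_of_surjective H.range_mkQ
  have hσ' : ∀ b, g (σ b) = b.1 := fun b => congrArg Subtype.val (LinearMap.congr_fun hσ b)
  let ρ : B →ₗ[k] LinearMap.ker g :=
    (LinearMap.id - σ.comp g.rangeRestrict).codRestrict _ fun x => by
      simp [hσ']
  have hmem : ∀ x, (ρ x - ι (H.mkQ (ρ x))).1 ∈ LinearMap.range f := fun x => by
    have : ρ x - ι (H.mkQ (ρ x)) ∈ H := by
      refine (Submodule.Quotient.mk_eq_zero H).1 ?_
      change H.mkQ _ = 0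
      rw [map_sub, sub_eq_zero]
      exact (LinearMap.congr_fun hι (H.mkQ (ρ x))).symm
    exact this
  refine Module.Projective.of_split (LinearMap.range f).subtype
    (((LinearMap.ker g).subtype.comp (ρ - ι.comp (H.mkQ.comp ρ))).codRestrict _ hmem) ?_
  ext x
  obtain ⟨x, y, rfl⟩ := x
  have hg : g (f y) = 0 := LinearMap.congr_fun hgf y
  have hr : g.rangeRestrict (f y) = 0 := Subtype.ext hg
  have hρ : ρ (f y) = ⟨f y, hg⟩ := Subtype.ext (by simp [ρ, hr])
  have hq : H.mkQ (ρ (f y)) = 0 := by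
    rw [← LinearMap.mem_ker, H.ker_mkQ, hρ]
    exact ⟨y, rfl⟩
  change (ρ (f y) - ι (H.mkQ (ρ (f y)))).1 = f y
  rw [hq, map_zero, sub_zero, hρ]

variable {k : Type*} [CommRing k]
  {D : ℤ → Type*} [∀ n, AddCommGroup (D n)] [∀ n, Module k (D n)]
  {dD : ∀ n m : ℤ, D n →ₗ[k] D m}

/-- The coboundaries of a bounded above complex of projectives with projective cohomology
are projective. -/
theorem projective_range
    (hDsq : ∀ n : ℤ, (dD (n + 1) (n + 1 + 1)).comp (dD n (n + 1)) = 0)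
    (hDproj : ∀ j : ℤ, Module.Projective k (D j))
    (hDbdd : ∃ N : ℤ, ∀ j : ℤ, N ≤ j → Subsingleton (D j))
    (hHproj : ∀ j : ℤ, Module.Projective k (cohomology k D dD j)) (n : ℤ) :
    Module.Projective k (LinearMap.range (dD n (n + 1))) := by
  obtain ⟨N, hN⟩ := hDbdd
  have key : ∀ t : ℕ, ∀ a : ℤ, N ≤ a + t →
      Module.Projective k (LinearMap.range (dD (a - 1) a)) := by
    intro t
    induction t with
    | zero =>
      intro a ha
      have := hN a (by simpa using ha)
      infer_instance
    | succ t ih =>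
      intro a ha
      have h1 := ih (a + 1) (by push_cast at ha; omega)
      rw [add_sub_cancel_right] at h1
      have := hDproj a
      have := hHproj a
      refine projective_range_of_comp_eq_zero (dD (a - 1) a) (dD a (a + 1)) ?_
      have := hDsq (a - 1)
      rwa [sub_add_cancel] at this
  have := key (N - (n + 1)).toNat (n + 1) (by omega)
  rwa [add_sub_cancel_right] at this

/-- A bounded above complex of projectives with projective cohomology is a deformation
retract of its cohomology. -/
theorem exists_contraction
    (hDsq : ∀ n : ℤ, (dD (n + 1) (n + 1 + 1)).comp (dD n (n + 1)) = 0)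
    (hDproj : ∀ j : ℤ, Module.Projective k (D j))
    (hDbdd : ∃ N : ℤ, ∀ j : ℤ, N ≤ j → Subsingleton (D j))
    (hHproj : ∀ j : ℤ, Module.Projective k (cohomology k D dD j)) :
    ∃ (π : ∀ j, D j →ₗ[k] cohomology k D dD j)
      (ι : ∀ j, cohomology k D dD j →ₗ[k] cocycles k D dD j)
      (s : ∀ a b, D a →ₗ[k] D b),
      (∀ j (z : cocycles k D dD j), π j z.1 = (cobdriesIn k D dD j).mkQ z) ∧
      (∀ j h, (cobdriesIn k D dD j).mkQ (ι j h) = h) ∧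
      ∀ a b c, b + 1 = a → a + 1 = c → ∀ x,
        dD b a (s a b x) + s c a (dD a c x) = x - (ι a (π a x)).1 := by
  have hσ : ∀ n m, ∃ σ : LinearMap.range (dD n m) →ₗ[k] D n,
      n + 1 = m → ∀ b, dD n m (σ b) = b.1 := by
    intro n m
    by_cases h : n + 1 = m
    · subst h
      have := projective_range hDsq hDproj hDbdd hHproj n
      obtain ⟨σ, hσ⟩ := (dD n (n + 1)).rangeRestrict.exists_rightInverse_of_surjective
        (dD n (n + 1)).range_rangeRestrict
      exact ⟨σ, fun _ b => congrArg Subtype.val (LinearMap.congr_fun hσ b)⟩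
    · exact ⟨0, fun h' => absurd h' h⟩
  choose σ hσ using hσ
  have hι : ∀ j, ∃ ι : cohomology k D dD j →ₗ[k] cocycles k D dD j,
      (cobdriesIn k D dD j).mkQ.comp ι = LinearMap.id := fun j =>
    have := hHproj j
    (cobdriesIn k D dD j).mkQ.exists_rightInverse_of_surjective (Submodule.range_mkQ _)
  choose ι hι using hι
  have hι' : ∀ j h, (cobdriesIn k D dD j).mkQ (ι j h) = h := fun j h =>
    LinearMap.congr_fun (hι j) h
  let ρ : ∀ j, D j →ₗ[k] cocycles k D dD j := fun j =>
    (LinearMap.id - (σ j (j + 1)).comp (dD j (j + 1)).rangeRestrict).codRestrict _ fun x => by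
      simp [hσ j (j + 1) rfl]
  have hρ : ∀ j (z : cocycles k D dD j), ρ j z.1 = z := by
    rintro j ⟨z, hz⟩
    have hr : (dD j (j + 1)).rangeRestrict z = 0 := Subtype.ext hz
    exact Subtype.ext (by simp [ρ, hr])
  let π : ∀ j, D j →ₗ[k] cohomology k D dD j := fun j => (cobdriesIn k D dD j).mkQ.comp (ρ j)
  have hmem : ∀ j x, (ρ j x - ι j (π j x)).1 ∈ LinearMap.range (dD (j - 1) j) := by
    intro j x
    have : ρ j x - ι j (π j x) ∈ cobdriesIn k D dD j := by
      refine (Submodule.Quotient.mk_eq_zero _).1 ?_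
      change (cobdriesIn k D dD j).mkQ _ = 0
      rw [map_sub, sub_eq_zero, hι']
      rfl
    exact this
  have hs : ∀ a b, ∃ s : D a →ₗ[k] D b, b + 1 = a →
      (∀ x, dD b a (s x) = (ρ a x).1 - (ι a (π a x)).1) ∧
      ∀ z, s (dD b a z) = σ b a ((dD b a).rangeRestrict z) := by
    intro a b
    by_cases h : b + 1 = a
    · obtain rfl : b = a - 1 := by omega
      let r : D a →ₗ[k] LinearMap.range (dD (a - 1) a) :=
        ((cocycles k D dD a).subtype.comp (ρ a - (ι a).comp (π a))).codRestrict _ (hmem a)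
      refine ⟨(σ (a - 1) a).comp r, fun _ => ⟨fun x => hσ _ _ h _, fun z => ?_⟩⟩
      rw [LinearMap.comp_apply]
      congr 1
      have hz : dD a (a + 1) (dD (a - 1) a z) = 0 := by
        have := hDsq (a - 1)
        rw [sub_add_cancel] at this
        exact LinearMap.congr_fun this z
      have h1 : ρ a (dD (a - 1) a z) = ⟨_, hz⟩ := hρ a ⟨_, hz⟩
      have h2 : π a (dD (a - 1) a z) = 0 := by
        change (cobdriesIn k D dD a).mkQ (ρ a _) = 0
        rw [h1, ← LinearMap.mem_ker, Submodule.ker_mkQ]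
        exact ⟨z, rfl⟩
      refine Subtype.ext ?_
      change (ρ a (dD (a - 1) a z) - ι a (π a (dD (a - 1) a z))).1 = dD (a - 1) a z
      rw [h1, h2, map_zero, sub_zero]
    · exact ⟨0, fun h' => absurd h' h⟩
  choose s hs using hs
  refine ⟨π, ι, s, fun j z => ?_, hι', fun a b c hb hc x => ?_⟩
  · change (cobdriesIn k D dD j).mkQ (ρ j z.1) = _
    rw [hρ]
  · subst hc
    rw [(hs a b hb).1, (hs (a + 1) a rfl).2]
    change x - σ a (a + 1) ((dD a (a + 1)).rangeRestrict x) - _ + _ = _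
    abel

end Contraction

section HomClass

variable {k : Type*} [CommRing k]
  {X : ℤ → Type*} [∀ n, AddCommGroup (X n)] [∀ n, Module k (X n)]
  {dX : ∀ n m : ℤ, X n →ₗ[k] X m}
  {M M' : Type*} [AddCommGroup M] [Module k M] [AddCommGroup M'] [Module k M'] {n : ℤ}

theorem homClass_congr {f : M →ₗ[k] X n} (hf : ∀ x, f x ∈ cocycles k X dX n)
    {g : M' →ₗ[k] X n} (hg : ∀ x, g x ∈ cocycles k X dX n) {x : M} {y : M'} (h : f x = g y) :
    homClass k X dX n f hf x = homClass k X dX n g hg y :=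
  congrArg (cobdriesIn k X dX n).mkQ (Subtype.ext h)

theorem homClass_eq_zero_iff {f : M →ₗ[k] X n} (hf : ∀ x, f x ∈ cocycles k X dX n) {x : M} :
    homClass k X dX n f hf x = 0 ↔ f x ∈ LinearMap.range (dX (n - 1) n) :=
  Submodule.Quotient.mk_eq_zero _

theorem exists_cocycle_homClass_eq (q : cohomology k X dX n) :
    ∃ z ∈ cocycles k X dX n, ∀ (f : M →ₗ[k] X n) (hf : ∀ x, f x ∈ cocycles k X dX n) (x : M),
      z - f x ∈ LinearMap.range (dX (n - 1) n) → homClass k X dX n f hf x = q := by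
  obtain ⟨z, rfl⟩ := Submodule.mkQ_surjective _ q
  exact ⟨z.1, z.2, fun f hf x h => by
    refine ((Submodule.Quotient.eq (cobdriesIn k X dX n) (x := z) (y := ⟨f x, hf x⟩)).2 ?_).symm
    exact h⟩

end HomClass

section Total

variable {k : Type*} [CommRing k]
  {C : ℤ → Type*} [∀ n, AddCommGroup (C n)] [∀ n, Module k (C n)]
  {dC : ∀ n m : ℤ, C n →ₗ[k] C m}
  {D : ℤ → Type*} [∀ n, AddCommGroup (D n)] [∀ n, Module k (D n)]
  {dD : ∀ n m : ℤ, D n →ₗ[k] D m}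

theorem lof_eq_lofIf {i j n : ℤ} (h : i + j = n) (x : C i ⊗[k] D j) :
    DirectSum.lof k (Idx n) (fun p => C p.1.1 ⊗[k] D p.1.2) ⟨(i, j), h⟩ x =
      lofIf k C D (i, j) n x := by
  rw [lofIf, dif_pos h]

theorem tensorCplx_hom_ext {n : ℤ} {M : Type*} [AddCommGroup M] [Module k M]
    {f g : tensorCplx k C D n →ₗ[k] M}
    (h : ∀ i j : ℤ, i + j = n → ∀ (c : C i) (y : D j),
      f (lofIf k C D (i, j) n (c ⊗ₜ y)) = g (lofIf k C D (i, j) n (c ⊗ₜ y))) : f = g := by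
  refine DirectSum.linearMap_ext _ fun p => TensorProduct.ext' fun c y => ?_
  obtain ⟨⟨i, j⟩, hij⟩ := p
  simpa only [LinearMap.comp_apply, lof_eq_lofIf] using h i j hij c y

theorem tensorD_lofIf {i j i' j' n m : ℤ} (hi : i + 1 = i') (hj : j + 1 = j') (hn : i + j = n)
    (c : C i) (y : D j) :
    tensorD k C dC D dD n m (lofIf k C D (i, j) n (c ⊗ₜ y)) =
      lofIf k C D (i', j) m (dC i i' c ⊗ₜ y) +
        (i.negOnePow : ℤ) • lofIf k C D (i, j') m (c ⊗ₜ dD j j' y) := by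
  subst hi hj
  rw [← lof_eq_lofIf hn, tensorD, DirectSum.toModule_lof]
  rfl

/-- The map of total complexes `1 ⊗ f` induced by maps `f` on the second factor. -/
noncomputable def tensorMap {E : ℤ → Type*} [∀ n, AddCommGroup (E n)] [∀ n, Module k (E n)]
    (f : ∀ j, D j →ₗ[k] E j) (n : ℤ) : tensorCplx k C D n →ₗ[k] tensorCplx k C E n :=
  DirectSum.lmap fun p : Idx n => TensorProduct.map LinearMap.id (f p.1.2)

theorem tensorMap_lofIf {E : ℤ → Type*} [∀ n, AddCommGroup (E n)] [∀ n, Module k (E n)]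
    (f : ∀ j, D j →ₗ[k] E j) {i j n : ℤ} (hn : i + j = n) (c : C i) (y : D j) :
    tensorMap f n (lofIf k C D (i, j) n (c ⊗ₜ y)) = lofIf k C E (i, j) n (c ⊗ₜ f j y) := by
  rw [← lof_eq_lofIf hn, ← lof_eq_lofIf hn, tensorMap, DirectSum.lmap_lof]
  rfl

/-- The signed operator `1 ⊗ s` of degree `-1` on the total complex. -/
noncomputable def tensorHomotopy (s : ∀ a b, D a →ₗ[k] D b) (n m : ℤ) :
    tensorCplx k C D n →ₗ[k] tensorCplx k C D m :=
  DirectSum.toModule k (Idx n) (tensorCplx k C D m) fun p =>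
    (p.1.1.negOnePow : ℤ) •
      (lofIf k C D (p.1.1, p.1.2 - 1) m).comp
        (TensorProduct.map LinearMap.id (s p.1.2 (p.1.2 - 1)))

theorem tensorHomotopy_lofIf (s : ∀ a b, D a →ₗ[k] D b) {i j j' n m : ℤ} (hj : j' + 1 = j)
    (hn : i + j = n) (c : C i) (y : D j) :
    tensorHomotopy s n m (lofIf k C D (i, j) n (c ⊗ₜ y)) =
      (i.negOnePow : ℤ) • lofIf k C D (i, j') m (c ⊗ₜ s j j' y) := by
  obtain rfl : j' = j - 1 := by omega
  rw [← lof_eq_lofIf hn, tensorHomotopy, DirectSum.toModule_lof]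
  rfl

theorem tensorHomotopy_spec {π : ∀ j, D j →ₗ[k] cohomology k D dD j}
    {ι : ∀ j, cohomology k D dD j →ₗ[k] cocycles k D dD j} {s : ∀ a b, D a →ₗ[k] D b}
    (hs : ∀ a b c, b + 1 = a → a + 1 = c → ∀ x,
        dD b a (s a b x) + s c a (dD a c x) = x - (ι a (π a x)).1)
    (n : ℤ) (t : tensorCplx k C D n) :
    tensorD k C dC D dD (n - 1) n (tensorHomotopy s n (n - 1) t) +
      tensorHomotopy s (n + 1) n (tensorD k C dC D dD n (n + 1) t) =
    t - tensorMap (fun j => (cocycles k D dD j).subtype.comp (ι j)) n (tensorMap π n t) := by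
  suffices h : (tensorD k C dC D dD (n - 1) n).comp (tensorHomotopy s n (n - 1)) +
      (tensorHomotopy s (n + 1) n).comp (tensorD k C dC D dD n (n + 1)) =
      LinearMap.id -
        (tensorMap (fun j => (cocycles k D dD j).subtype.comp (ι j)) n).comp (tensorMap π n) from
    LinearMap.congr_fun h t
  refine tensorCplx_hom_ext fun i j hij c y => ?_
  simp only [LinearMap.add_apply, LinearMap.sub_apply, LinearMap.comp_apply, LinearMap.id_apply]
  rw [tensorHomotopy_lofIf s (sub_add_cancel j 1) hij, map_zsmul,
    tensorD_lofIf rfl (sub_add_cancel j 1) (by omega), tensorD_lofIf rfl rfl hij, map_add,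
    map_zsmul, tensorHomotopy_lofIf s (sub_add_cancel j 1) (by omega),
    tensorHomotopy_lofIf s rfl (by omega), tensorMap_lofIf _ hij, tensorMap_lofIf _ hij,
    LinearMap.comp_apply, Submodule.subtype_apply, ← map_sub, ← TensorProduct.tmul_sub,
    ← hs j (j - 1) (j + 1) (sub_add_cancel j 1) rfl y, TensorProduct.tmul_add, map_add, smul_add,
    smul_smul, ← Units.val_mul, Int.units_mul_self, Units.val_one, one_smul, Int.negOnePow_succ,
    Units.val_neg, neg_smul, smul_smul, ← Units.val_mul, Int.units_mul_self, Units.val_one,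
    one_smul]
  abel

/-- Projections `π` vanishing on coboundaries intertwine the total differential with `dC ⊗ 1`. -/
theorem tensorMap_tensorD_apply {E : ℤ → Type*} [∀ n, AddCommGroup (E n)]
    [∀ n, Module k (E n)] {π : ∀ j, D j →ₗ[k] E j}
    (hπ : ∀ j x, π (j + 1) (dD j (j + 1) x) = 0)
    {i i' j n m : ℤ} (hi : i + 1 = i') (hn : i + j = n) (hm : i' + j = m)
    (t : tensorCplx k C D n) :
    tensorMap π m (tensorD k C dC D dD n m t) ⟨(i', j), hm⟩ =
      (dC i i').rTensor (E j) (tensorMap π n t ⟨(i, j), hn⟩) := by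
  subst hi
  let P (n) (p : Idx n) := DirectSum.component k (Idx n) (fun p => C p.1.1 ⊗[k] E p.1.2) p
  suffices h : (P m ⟨(i + 1, j), hm⟩).comp ((tensorMap π m).comp (tensorD k C dC D dD n m)) =
      ((dC i (i + 1)).rTensor (E j)).comp ((P n ⟨(i, j), hn⟩).comp (tensorMap π n)) from
    LinearMap.congr_fun h t
  refine tensorCplx_hom_ext fun a b hab c y => ?_
  simp only [LinearMap.comp_apply]
  rw [tensorD_lofIf rfl rfl hab, map_add, map_zsmul, tensorMap_lofIf _ (by omega),
    tensorMap_lofIf _ (by omega), tensorMap_lofIf _ hab, hπ, TensorProduct.tmul_zero, map_zero,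
    smul_zero, add_zero, ← lof_eq_lofIf hab, ← lof_eq_lofIf (show a + 1 + b = m by omega)]
  by_cases h : a = i
  · subst h
    obtain rfl : b = j := by omega
    simp only [P, DirectSum.component.lof_self, LinearMap.rTensor_tmul]
  · simp only [P, DirectSum.component.of]
    rw [dif_neg (by simp [h]), dif_neg (by simp [h]), map_zero]

variable (dC) in
/-- Classes of cocycles in the first factor, tensored with cohomology of the second. -/
noncomputable def classMap (n : ℤ) :
    (DirectSum (Idx n) fun p => cocycles k C dC p.1.1 ⊗[k] cohomology k D dD p.1.2) →ₗ[k]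
      DirectSum (Idx n) fun p => cohomology k C dC p.1.1 ⊗[k] cohomology k D dD p.1.2 :=
  DirectSum.lmap fun p => (cobdriesIn k C dC p.1.1).mkQ.rTensor (cohomology k D dD p.1.2)

variable (dC dD) in
/-- The inclusion of `Z^i(C) ⊗ H^j(D)` into `C^i ⊗ H^j(D)` on all summands. -/
noncomputable def inclMap (n : ℤ) :
    (DirectSum (Idx n) fun p => cocycles k C dC p.1.1 ⊗[k] cohomology k D dD p.1.2) →ₗ[k]
      tensorCplx k C (cohomology k D dD) n :=
  DirectSum.lmap fun p => (cocycles k C dC p.1.1).subtype.rTensor (cohomology k D dD p.1.2)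

variable (dC) in
/-- The cochain `z ⊗ ι h` attached to a cocycle `z` and a cohomology class `h`. -/
noncomputable def representative (ι : ∀ j, cohomology k D dD j →ₗ[k] cocycles k D dD j) (n : ℤ) :
    (DirectSum (Idx n) fun p => cocycles k C dC p.1.1 ⊗[k] cohomology k D dD p.1.2) →ₗ[k]
      tensorCplx k C D n :=
  (tensorMap (fun j => (cocycles k D dD j).subtype.comp (ι j)) n).comp (inclMap dC dD n)

theorem representative_lof (ι : ∀ j, cohomology k D dD j →ₗ[k] cocycles k D dD j) (n : ℤ)
    (p : Idx n) (z : cocycles k C dC p.1.1) (h : cohomology k D dD p.1.2) :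
    representative dC ι n (DirectSum.lof k _ _ p (z ⊗ₜ h)) =
      cocycleTensor k C dC D dD n p (z ⊗ₜ ι _ h) := by
  rw [representative, LinearMap.comp_apply, inclMap, DirectSum.lmap_lof, tensorMap,
    DirectSum.lmap_lof]
  rfl

variable (dC) in
theorem representative_mem (ι : ∀ j, cohomology k D dD j →ₗ[k] cocycles k D dD j) (n : ℤ)
    (w : DirectSum (Idx n) fun p => cocycles k C dC p.1.1 ⊗[k] cohomology k D dD p.1.2) :
    representative dC ι n w ∈ cocycles k (tensorCplx k C D) (tensorD k C dC D dD) n := by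
  suffices h : (tensorD k C dC D dD n (n + 1)).comp (representative dC ι n) = 0 from
    LinearMap.congr_fun h w
  refine DirectSum.linearMap_ext _ fun p => TensorProduct.ext' fun z h => ?_
  simp only [LinearMap.comp_apply]
  rw [representative_lof]
  exact cocycleTensor_mem k C dC D dD n p _

theorem kunnethPiece_mk (n : ℤ) (p : Idx n) (z : cocycles k C dC p.1.1)
    (d : cocycles k D dD p.1.2) :
    kunnethPiece k C dC D dD n p
        ((cobdriesIn k C dC p.1.1).mkQ z ⊗ₜ (cobdriesIn k D dD p.1.2).mkQ d) =
      cocycleTensorH k C dC D dD n p (z ⊗ₜ d) :=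
  rfl

theorem kunnethMap_comp_classMap {ι : ∀ j, cohomology k D dD j →ₗ[k] cocycles k D dD j}
    (hι : ∀ j h, (cobdriesIn k D dD j).mkQ (ι j h) = h) (n : ℤ) :
    (kunnethMap k C dC D dD n).comp (classMap dC n) =
      homClass k (tensorCplx k C D) (tensorD k C dC D dD)
        (M := DirectSum (Idx n) fun p => cocycles k C dC p.1.1 ⊗[k] cohomology k D dD p.1.2) n
        (representative dC ι n) (representative_mem dC ι n) := by
  refine DirectSum.linearMap_ext _ fun p => TensorProduct.ext' fun z h => ?_
  have hl : kunnethMap k C dC D dD n (classMap dC n (DirectSum.lof k _ _ p (z ⊗ₜ h))) =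
      kunnethPiece k C dC D dD n p ((cobdriesIn k C dC p.1.1).mkQ z ⊗ₜ h) := by
    rw [classMap, DirectSum.lmap_lof, kunnethMap, DirectSum.toModule_lof, LinearMap.rTensor_tmul]
  refine hl.trans ?_
  conv_lhs => rw [← hι _ h]
  rw [kunnethPiece_mk]
  exact homClass_congr
    (M' := DirectSum (Idx n) fun p => cocycles k C dC p.1.1 ⊗[k] cohomology k D dD p.1.2)
    (cocycleTensor_mem k C dC D dD n p) (representative_mem dC ι n)
    (representative_lof ι n p z h).symm

end Total

end Kunneth

open Kunneth in
/-- Let `D•` be a cochain complex of projective `k`-modules, bounded above,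
such that `H^j(D•)` is projective for every `j`.  Then for every cochain complex `C•` of
`k`-modules and every integer `n`, the natural map
`⊕_{i+j=n} H^i(C•) ⊗ H^j(D•) → H^n(C• ⊗ D•)` is an isomorphism. -/
theorem statement0 (k : Type*) [CommRing k]
    (C : ℤ → Type*) [∀ n, AddCommGroup (C n)] [∀ n, Module k (C n)]
    (dC : ∀ n m : ℤ, C n →ₗ[k] C m)
    (hCshape : ∀ n m : ℤ, m ≠ n + 1 → dC n m = 0)
    (hCsq : ∀ n : ℤ, (dC (n + 1) (n + 1 + 1)).comp (dC n (n + 1)) = 0)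
    (D : ℤ → Type*) [∀ n, AddCommGroup (D n)] [∀ n, Module k (D n)]
    (dD : ∀ n m : ℤ, D n →ₗ[k] D m)
    (hDshape : ∀ n m : ℤ, m ≠ n + 1 → dD n m = 0)
    (hDsq : ∀ n : ℤ, (dD (n + 1) (n + 1 + 1)).comp (dD n (n + 1)) = 0)
    (hDproj : ∀ j : ℤ, Module.Projective k (D j))
    (hDbdd : ∃ N : ℤ, ∀ j : ℤ, N ≤ j → Subsingleton (D j))
    (hHproj : ∀ j : ℤ, Module.Projective k (cohomology k D dD j)) :
    ∀ n : ℤ, Function.Bijective (kunnethMap k C dC D dD n) := by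
  intro n
  obtain ⟨π, ι, s, hπ, hι, hs⟩ := exists_contraction hDsq hDproj hDbdd hHproj
  have hπd : ∀ j x, π (j + 1) (dD j (j + 1) x) = 0 := fun j x => by
    rw [hπ (j + 1) ⟨dD j (j + 1) x, LinearMap.congr_fun (hDsq j) x⟩, ← LinearMap.mem_ker,
      Submodule.ker_mkQ]
    change dD j (j + 1) x ∈ LinearMap.range (dD (j + 1 - 1) (j + 1))
    rw [add_sub_cancel_right]
    exact ⟨x, rfl⟩
  constructor
  · let (p : Idx n) : AddCommGroup (cohomology k C dC p.1.1 ⊗[k] cohomology k D dD p.1.2) :=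
      inferInstance
    rw [injective_iff_map_eq_zero]
    intro x hx
    obtain ⟨w, rfl⟩ : ∃ w, classMap dC n w = x :=
      (DirectSum.lmap_surjective _).2
        (fun p => LinearMap.rTensor_surjective _ (Submodule.mkQ_surjective _)) x
    have hw := LinearMap.congr_fun (kunnethMap_comp_classMap (dC := dC) hι n) w
    obtain ⟨t, ht⟩ := (homClass_eq_zero_iff _).1 (hw.symm.trans hx)
    have hincl : tensorMap π n (tensorD k C dC D dD (n - 1) n t) = inclMap dC dD n w := by
      rw [ht]
      refine DFinsupp.ext fun p => ?_
      change TensorProduct.map _ _ (TensorProduct.map _ _ (inclMap dC dD n w p)) = _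
      rw [← LinearMap.comp_apply, ← TensorProduct.map_comp, LinearMap.comp_id]
      have : (π p.1.2).comp ((cocycles k D dD p.1.2).subtype.comp (ι p.1.2)) =
          LinearMap.id := LinearMap.ext fun h => (hπ _ _).trans (hι _ h)
      rw [this, TensorProduct.map_id, LinearMap.id_apply]
    refine DFinsupp.ext fun p => ?_
    obtain ⟨⟨i, j⟩, hij⟩ := p
    have hp := tensorMap_tensorD_apply (dC := dC) hπd (sub_add_cancel i 1)
      (show i - 1 + j = n - 1 by omega) hij t
    rw [hincl] at hp
    have hd : ∀ c, dC (i - 1) i c ∈ cocycles k C dC i := fun c => by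
      have := hCsq (i - 1)
      rw [sub_add_cancel] at this
      exact LinearMap.congr_fun this c
    set u := tensorMap π (n - 1) t ⟨(i - 1, j), by omega⟩
    have hwu : w ⟨(i, j), hij⟩ =
        ((dC (i - 1) i).codRestrict (cocycles k C dC i) hd).rTensor (cohomology k D dD j) u := by
      have := hHproj j
      refine Module.Flat.rTensor_preserves_injective_linearMap (M := cohomology k D dD j)
        (cocycles k C dC i).subtype (Submodule.subtype_injective _) ?_
      rw [← LinearMap.comp_apply, ← LinearMap.rTensor_comp, LinearMap.subtype_comp_codRestrict]
      exact hp
    change (cobdriesIn k C dC i).mkQ.rTensor (cohomology k D dD j) (w ⟨(i, j), hij⟩) = 0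
    rw [hwu, ← LinearMap.comp_apply, ← LinearMap.rTensor_comp]
    have : (cobdriesIn k C dC i).mkQ.comp
        ((dC (i - 1) i).codRestrict (cocycles k C dC i) hd) = 0 := by
      refine LinearMap.ext fun c => ?_
      rw [LinearMap.comp_apply, LinearMap.zero_apply, ← LinearMap.mem_ker, Submodule.ker_mkQ]
      exact ⟨c, rfl⟩
    rw [this, LinearMap.rTensor_zero, LinearMap.zero_apply]
  · intro q
    obtain ⟨z, hz, hq⟩ := exists_cocycle_homClass_eq
      (M := DirectSum (Idx n) fun p => cocycles k C dC p.1.1 ⊗[k] cohomology k D dD p.1.2) q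
    obtain ⟨w, hw⟩ : tensorMap π n z ∈ LinearMap.range (inclMap dC dD n) := by
      rw [inclMap, DirectSum.range_lmap]
      rintro ⟨⟨i, j⟩, hij⟩ -
      have := hHproj j
      have hex := Module.Flat.rTensor_exact (cohomology k D dD j)
        (LinearMap.exact_subtype_ker_map (dC i (i + 1)))
      refine (hex _).1 ?_
      change (dC i (i + 1)).rTensor (cohomology k D dD j) (tensorMap π n z ⟨(i, j), hij⟩) = 0
      rw [← tensorMap_tensorD_apply hπd rfl hij (show i + 1 + j = n + 1 by omega),
        LinearMap.mem_ker.mp hz, map_zero]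
      rfl
    refine ⟨classMap dC n w,
      (LinearMap.congr_fun (kunnethMap_comp_classMap (dC := dC) hι n) w).trans
        (hq _ _ w ⟨tensorHomotopy s n (n - 1) z, ?_⟩)⟩
    have := tensorHomotopy_spec (dC := dC) hs n z
    rw [LinearMap.mem_ker.mp hz, map_zero, add_zero, ← hw] at this
    exact this
end

section
/- Let D• be a bounded above cochain complex of projective k-modules such that H^j(D•) is a projective k-module for every j. Let B^j ⊆ D^j denote the submodule of j-coboundaries (the image of the differential D^{j-1} → D^j). Then D• is isomorphic, as a cochain complex of k-modules, to the complex whose j-th term is B^j ⊕ H^j(D•) ⊕ B^{j+1} and whose differential sends (b, h, b') to (b', 0, 0). -/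
namespace Statement1

variable (k : Type*) [CommRing k]
variable (D : ℤ → Type*) [∀ n, AddCommGroup (D n)] [∀ n, Module k (D n)]
variable (d : ∀ n m : ℤ, D n →ₗ[k] D m)

/-- The `n`-cocycles of the cochain complex `(D, d)`. -/
abbrev cocycles (n : ℤ) : Submodule k (D n) := LinearMap.ker (d n (n + 1))

/-- The `n`-coboundaries `B^n`, i.e. the image of the differential `D^{n-1} → D^n`. -/
abbrev cobdries (n : ℤ) : Submodule k (D n) := LinearMap.range (d (n - 1) n)

/-- The coboundaries viewed as a submodule of the cocycles. -/
abbrev cobdriesIn (n : ℤ) : Submodule k (cocycles k D d n) :=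
  (cobdries k D d n).comap (cocycles k D d n).subtype

/-- The `n`-th cohomology of the cochain complex `(D, d)`. -/
abbrev cohomology (n : ℤ) : Type _ := cocycles k D d n ⧸ cobdriesIn k D d n

end Statement1

/-- If `B ≤ ker δ` with `δ : M → C` surjective, and both `C` and `ker δ / B` are projective, then
`M` splits as `B × (ker δ / B) × C`, compatibly with the inclusion of `B` and with `δ`. -/
theorem exists_linearEquiv_prod_quotient_ker {k M C : Type*} [CommRing k]
    [AddCommGroup M] [Module k M] [AddCommGroup C] [Module k C]
    (δ : M →ₗ[k] C) (hδ : Function.Surjective δ) (Z B : Submodule k M)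
    (hZ : Z = LinearMap.ker δ) (hB : B ≤ Z)
    [Module.Projective k C] [Module.Projective k (Z ⧸ B.comap Z.subtype)] :
    ∃ e : M ≃ₗ[k] (B × (Z ⧸ B.comap Z.subtype) × C),
      (∀ x, (e x).2.2 = δ x) ∧ ∀ b : B, e b = (b, 0, 0) := by
  obtain ⟨s, hs⟩ := Module.projective_lifting_property δ LinearMap.id hδ
  obtain ⟨t, ht⟩ := Module.projective_lifting_property (B.comap Z.subtype).mkQ LinearMap.id
    (Submodule.mkQ_surjective _)
  replace hs (c : C) : δ (s c) = c := LinearMap.congr_fun hs c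
  replace ht (h : Z ⧸ B.comap Z.subtype) : (B.comap Z.subtype).mkQ (t h) = h :=
    LinearMap.congr_fun ht h
  have hδZ (z : Z) : δ z = 0 := LinearMap.mem_ker.1 (hZ ▸ z.2)
  have hδB (b : B) : δ b = 0 := hδZ ⟨b, hB b.2⟩
  let f : (B × (Z ⧸ B.comap Z.subtype) × C) →ₗ[k] M :=
    B.subtype.coprod ((Z.subtype ∘ₗ t).coprod s)
  have hf (b : B) (h : Z ⧸ B.comap Z.subtype) (c : C) : f (b, h, c) = b + (t h + s c) := rfl
  have hδf (b : B) (h : Z ⧸ B.comap Z.subtype) (c : C) : δ (f (b, h, c)) = c := by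
    simp [hf, hδB, hδZ, hs]
  have hinj : Function.Injective f := by
    rw [← LinearMap.ker_eq_bot, LinearMap.ker_eq_bot']
    rintro ⟨b, h, c⟩ h0
    obtain rfl : c = 0 := by rw [← hδf b h c, h0, map_zero]
    have hth : (t h : M) = -b := by
      rw [hf, map_zero, add_zero] at h0
      exact eq_neg_of_add_eq_zero_right h0
    obtain rfl : h = 0 := by
      rw [← ht h, Submodule.mkQ_apply, Submodule.Quotient.mk_eq_zero, Submodule.mem_comap,
        Submodule.subtype_apply, hth]
      exact B.neg_mem b.2
    have hb : b = 0 := by simpa [hf] using h0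
    rw [hb]
    rfl
  have hsurj : Function.Surjective f := by
    intro x
    have hz : x - s (δ x) ∈ Z := by simp [hZ, hs]
    let z : Z := ⟨x - s (δ x), hz⟩
    have hb : z - t ((B.comap Z.subtype).mkQ z) ∈ B.comap Z.subtype := by
      rw [← Submodule.Quotient.mk_eq_zero, ← Submodule.mkQ_apply, map_sub, ht, sub_self]
    refine ⟨(⟨_, hb⟩, (B.comap Z.subtype).mkQ z, δ x), ?_⟩
    simp only [hf, Submodule.subtype_apply, Submodule.coe_sub]
    change x - s (δ x) - _ + (_ + _) = x
    abel
  let e := LinearEquiv.ofBijective f ⟨hinj, hsurj⟩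
  refine ⟨e.symm, fun x => ?_, fun b => ?_⟩
  · obtain ⟨⟨b, h, c⟩, rfl⟩ := e.surjective x
    rw [e.symm_apply_apply]
    exact (hδf b h c).symm
  · rw [e.symm_apply_eq]
    change (b : M) = f (b, 0, 0)
    simp [hf]

open Statement1 in
/-- Let `D•` be a bounded above cochain complex of projective `k`-modules
such that `H^j(D•)` is projective for every `j`.  Then `D•` is isomorphic, as a cochain
complex of `k`-modules, to the complex whose `j`-th term is `B^j ⊕ H^j(D•) ⊕ B^{j+1}` and
whose differential sends `(b, h, b')` to `(b', 0, 0)`. -/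
theorem statement1 (k : Type*) [CommRing k]
    (D : ℤ → Type*) [∀ n, AddCommGroup (D n)] [∀ n, Module k (D n)]
    (d : ∀ n m : ℤ, D n →ₗ[k] D m)
    (hshape : ∀ n m : ℤ, m ≠ n + 1 → d n m = 0)
    (hsq : ∀ n : ℤ, (d (n + 1) (n + 1 + 1)).comp (d n (n + 1)) = 0)
    (hbdd : ∃ N : ℤ, ∀ j : ℤ, N ≤ j → Subsingleton (D j))
    (hproj : ∀ j : ℤ, Module.Projective k (D j))
    (hHproj : ∀ j : ℤ, Module.Projective k (cohomology k D d j)) :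
    ∃ e : ∀ j : ℤ, D j ≃ₗ[k] (cobdries k D d j × cohomology k D d j × cobdries k D d (j + 1)),
      ∀ (j : ℤ) (x : D j),
        e (j + 1) (d j (j + 1) x) = ((e j x).2.2, 0, 0) := by
  have hrange (j : ℤ) : cobdries k D d (j + 1) = LinearMap.range (d j (j + 1)) := by
    have h (m : ℤ) (hm : m = j) :
        LinearMap.range (d m (j + 1)) = LinearMap.range (d j (j + 1)) := by
      rw [hm]
    exact h _ (add_sub_cancel_right j 1)
  have hle (j : ℤ) : cobdries k D d j ≤ cocycles k D d j := by
    obtain ⟨i, rfl⟩ : ∃ i, j = i + 1 := ⟨j - 1, (sub_add_cancel j 1).symm⟩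
    rw [hrange, LinearMap.range_le_ker_iff]
    exact hsq i
  let δ (j : ℤ) : D j →ₗ[k] cobdries k D d (j + 1) :=
    (d j (j + 1)).codRestrict _ fun x => hrange j ▸ LinearMap.mem_range_self _ x
  have hδ (j : ℤ) : Function.Surjective (δ j) := by
    rintro ⟨y, hy⟩
    obtain ⟨x, hx⟩ := hrange j ▸ hy
    exact ⟨x, Subtype.ext hx⟩
  have hker (j : ℤ) : cocycles k D d j = LinearMap.ker (δ j) :=
    (LinearMap.ker_codRestrict _ _ _).symm
  have key (j : ℤ) (hC : Module.Projective k (cobdries k D d (j + 1))) :=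
    have := hHproj j
    exists_linearEquiv_prod_quotient_ker (δ j) (hδ j) _ _ (hker j) (hle j)
  have hBproj (j : ℤ) : Module.Projective k (cobdries k D d j) := by
    obtain ⟨N, hN⟩ := hbdd
    have h (n : ℕ) : ∀ j : ℤ, N ≤ j + n → Module.Projective k (cobdries k D d j) := by
      induction n with
      | zero =>
        intro j hj
        have := hN j (by simpa using hj)
        infer_instance
      | succ n ih =>
        intro j hj
        obtain ⟨e, -, he⟩ := key j (ih (j + 1) (by push_cast at hj; linarith))
        have := hproj j
        exact Module.Projective.of_split (cobdries k D d j).subtype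
          (LinearMap.fst k _ _ ∘ₗ e.toLinearMap)
          (LinearMap.ext fun b => congrArg Prod.fst (he b))
    exact h (N - j).toNat j (by have := Int.self_le_toNat (N - j); linarith)
  choose e he₁ he₂ using fun j => key j (hBproj (j + 1))
  refine ⟨e, fun j x => ?_⟩
  rw [he₁]
  exact he₂ (j + 1) (δ j x)
end

section
/- Let s be a sequence, γ ∈ Γ(s), λ ∈ Γ(s^{(γ)}) and δ ∈ Γ(s^{(γ∘λ)}). Then the composition is associative: (γ∘λ)∘δ = γ∘(λ∘δ). Moreover, γ∘ε = γ and ε∘λ = λ. -/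
/-- The prefix product `γ^(j) = γ₁ ⋯ γⱼ` of the first `j` entries of a sequence. -/
def prefProd {W : Type*} [Group W] {n : ℕ} (γ : Fin n → W) (j : ℕ) : W :=
  ((List.ofFn γ).take j).prod

/-- `γ ∈ Γ(s)`: a generalized combinatorial gallery for the sequence `s`. -/
def IsGallery {W : Type*} [Group W] {n : ℕ} (s γ : Fin n → W) : Prop :=
  ∀ i, γ i = 1 ∨ γ i = s i

/-- The sequence `s^{(γ)}` defined by `s^{(γ)}ᵢ = γ^(i) · sᵢ · (γ^(i))⁻¹`. -/
def conjSeq {W : Type*} [Group W] {n : ℕ} (s γ : Fin n → W) : Fin n → W :=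
  fun i => prefProd γ (i.val + 1) * s i * (prefProd γ (i.val + 1))⁻¹

/-- The composition `γ∘λ`, given by `(γ∘λ)ᵢ = (γ^(i−1))⁻¹ · λᵢ · γ^(i)`. -/
def compGal {W : Type*} [Group W] {n : ℕ} (γ lam : Fin n → W) : Fin n → W :=
  fun i => (prefProd γ i.val)⁻¹ * lam i * prefProd γ (i.val + 1)

/-- The constant sequence `ε` with all entries `1`. -/
def epsGal {W : Type*} [Group W] (n : ℕ) : Fin n → W := fun _ => 1

/-- The inverse sequence `γ⁻¹`, given by `(γ⁻¹)ᵢ = γ^(i−1) · (γ^(i))⁻¹`. -/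
def invGal {W : Type*} [Group W] {n : ℕ} (γ : Fin n → W) : Fin n → W :=
  fun i => prefProd γ i.val * (prefProd γ (i.val + 1))⁻¹

theorem prefProd_zero {W : Type*} [Group W] {n : ℕ} (γ : Fin n → W) : prefProd γ 0 = 1 := by
  simp [prefProd]

theorem prefProd_succ {W : Type*} [Group W] {n : ℕ} (γ : Fin n → W) {j : ℕ} (hj : j < n) :
    prefProd γ (j + 1) = prefProd γ j * γ ⟨j, hj⟩ := by
  simp [prefProd, List.prod_take_succ, hj]

theorem prefProd_epsGal {W : Type*} [Group W] {n : ℕ} (j : ℕ) :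
    prefProd (epsGal n : Fin n → W) j = 1 := by
  refine List.prod_eq_one fun x hx => ?_
  obtain ⟨_, rfl⟩ := List.mem_ofFn.mp (List.mem_of_mem_take hx)
  rfl

theorem prefProd_compGal {W : Type*} [Group W] {n : ℕ} (γ lam : Fin n → W) {j : ℕ}
    (hj : j ≤ n) : prefProd (compGal γ lam) j = prefProd lam j * prefProd γ j := by
  induction j with
  | zero => simp [prefProd_zero]
  | succ j ih =>
    rw [prefProd_succ _ hj, ih (Nat.le_of_succ_le hj), prefProd_succ lam hj]
    simp [compGal, mul_assoc]

/-- Let `s` be a sequence, `γ ∈ Γ(s)`, `λ ∈ Γ(s^{(γ)})` and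
`δ ∈ Γ(s^{(γ∘λ)})`. Then the composition is associative: `(γ∘λ)∘δ = γ∘(λ∘δ)`.
Moreover, `γ∘ε = γ` and `ε∘λ = λ`. -/
theorem statement6 {W : Type*} [Group W] {n : ℕ} (s γ lam δ : Fin n → W)
    (hγ : IsGallery s γ) (hlam : IsGallery (conjSeq s γ) lam)
    (hδ : IsGallery (conjSeq s (compGal γ lam)) δ) :
    compGal (compGal γ lam) δ = compGal γ (compGal lam δ) ∧
    compGal γ (epsGal n) = γ ∧
    compGal (epsGal n) lam = lam := by
  refine ⟨?_, ?_, ?_⟩ <;> funext i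
  · simp only [compGal.eq_def (compGal γ lam), compGal.eq_def γ (compGal lam δ),
      prefProd_compGal γ lam i.isLt.le, prefProd_compGal γ lam (Nat.succ_le_of_lt i.isLt)]
    simp [compGal, mul_assoc]
  · simp [compGal, epsGal, prefProd_succ γ i.isLt]
  · simp [compGal, prefProd_epsGal]
end

section
/- Let R be a nested structure on I and let F ⊆ R be a nonempty subset such that the intervals [f], f ∈ F, are pairwise disjoint. Set I^F = I ∖ ⋃_{f∈F}[f] and R^F = R ∖ {r ∈ R | there exists f ∈ F with [r] ⊆ [f]}. Then every r ∈ R^F has both endpoints in I^F, and R^F is a nested structure on the finite linearly ordered set I^F. -/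
/-- `NestedOn J R`: `R` is a nested structure on the (sub)set `J` of the finite linearly
ordered set `I`.  The conditions are: endpoints lie in `J`; `r₁ ≤ r₂`; distinct pairs have
no common endpoints; and the intervals (taken inside `J`) are either disjoint or one is
contained in the other. -/
def NestedOn {I : Type*} [LinearOrder I] (J : Set I) (R : Set (I × I)) : Prop :=
  (∀ r ∈ R, r.1 ∈ J ∧ r.2 ∈ J) ∧
  (∀ r ∈ R, r.1 ≤ r.2) ∧
  (∀ r ∈ R, ∀ r' ∈ R, r ≠ r' →
      r.1 ≠ r'.1 ∧ r.1 ≠ r'.2 ∧ r.2 ≠ r'.1 ∧ r.2 ≠ r'.2) ∧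
  (∀ r ∈ R, ∀ r' ∈ R,
      (Set.Icc r.1 r.2 ∩ J) ∩ (Set.Icc r'.1 r'.2 ∩ J) = ∅ ∨
      Set.Icc r.1 r.2 ∩ J ⊆ Set.Icc r'.1 r'.2 ∩ J ∨
      Set.Icc r'.1 r'.2 ∩ J ⊆ Set.Icc r.1 r.2 ∩ J)

/-- In a nested structure, an interval of `R` not contained in the interval of `f ∈ R` has both
endpoints outside of the latter. -/
theorem NestedOn.endpoints_notMem_Icc {I : Type*} [LinearOrder I] {R : Set (I × I)}
    (hR : NestedOn Set.univ R) {r f : I × I} (hr : r ∈ R) (hf : f ∈ R)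
    (hrf : ¬ Set.Icc r.1 r.2 ⊆ Set.Icc f.1 f.2) :
    r.1 ∉ Set.Icc f.1 f.2 ∧ r.2 ∉ Set.Icc f.1 f.2 := by
  obtain ⟨-, hle, hne, hnest⟩ := hR
  have hr_le := hle r hr
  have hf_le := hle f hf
  obtain ⟨h11, -, -, h22⟩ := hne r hr f hf (by rintro rfl; exact hrf subset_rfl)
  have hcases := hnest r hr f hf
  simp only [Set.inter_univ] at hcases
  rcases hcases with h | h | h
  · exact ⟨fun hm => (h ▸ ⟨Set.left_mem_Icc.2 hr_le, hm⟩ : r.1 ∈ (∅ : Set I)),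
      fun hm => (h ▸ ⟨Set.right_mem_Icc.2 hr_le, hm⟩ : r.2 ∈ (∅ : Set I))⟩
  · exact absurd h hrf
  · exact ⟨fun hm => h11 (le_antisymm (h (Set.left_mem_Icc.2 hf_le)).1 hm.1),
      fun hm => h22 (le_antisymm hm.2 (h (Set.right_mem_Icc.2 hf_le)).2)⟩

/-- Let `R` be a nested structure on `I` and `F ⊆ R` a nonempty subset whose
intervals are pairwise disjoint.  Set `I^F = I ∖ ⋃_{f∈F}[f]` and
`R^F = R ∖ {r ∈ R | ∃ f ∈ F, [r] ⊆ [f]}`.  Then every `r ∈ R^F` has both endpoints in `I^F`,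
and `R^F` is a nested structure on the finite linearly ordered set `I^F`. -/
theorem statement9 {I : Type*} [Fintype I] [LinearOrder I]
    (R : Set (I × I)) (hR : NestedOn Set.univ R)
    (F : Set (I × I)) (hFR : F ⊆ R) (hFne : F.Nonempty)
    (hdisj : ∀ f ∈ F, ∀ f' ∈ F, f ≠ f' → Set.Icc f.1 f.2 ∩ Set.Icc f'.1 f'.2 = ∅) :
    NestedOn {i : I | ∀ f ∈ F, i ∉ Set.Icc f.1 f.2}
      {r ∈ R | ¬ ∃ f ∈ F, Set.Icc r.1 r.2 ⊆ Set.Icc f.1 f.2} := by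
  have hends : ∀ r ∈ R, (¬ ∃ f ∈ F, Set.Icc r.1 r.2 ⊆ Set.Icc f.1 f.2) →
      ∀ f ∈ F, r.1 ∉ Set.Icc f.1 f.2 ∧ r.2 ∉ Set.Icc f.1 f.2 := fun r hr hrF f hf =>
    hR.endpoints_notMem_Icc hr (hFR hf) fun hsub => hrF ⟨f, hf, hsub⟩
  obtain ⟨-, hle, hne, hnest⟩ := hR
  refine ⟨fun r hr => ⟨fun f hf => (hends r hr.1 hr.2 f hf).1,
    fun f hf => (hends r hr.1 hr.2 f hf).2⟩, fun r hr => hle r hr.1,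
    fun r hr r' hr' => hne r hr.1 r' hr'.1, fun r hr r' hr' => ?_⟩
  have hcases := hnest r hr.1 r' hr'.1
  simp only [Set.inter_univ] at hcases
  rcases hcases with h | h | h
  · left
    rw [← Set.inter_inter_distrib_right, h, Set.empty_inter]
  · exact Or.inr (Or.inl (Set.inter_subset_inter_left _ h))
  · exact Or.inr (Or.inr (Set.inter_subset_inter_left _ h))
end

section
/- Assume R is nonempty. Then the map γ ↦ (p^F_K(γ), γ|_{[f¹]}, …, γ|_{[f^𝔫]}) is a bijection from Γ(s,v) onto the product Γ(s^F) × Γ(s_{f¹}, v_{f¹}) × ⋯ × Γ(s_{f^𝔫}, v_{f^𝔫}), where Γ(s^F) = {δ : I^F → W | for every i ∈ I^F, δ_i = 1 or δ_i = s^F_i}. -/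
/-- The ordered product `∏_{i ∈ A} γᵢ` of the values of `γ` over a finite subset `A`
of a linearly ordered set, taken in increasing order of the indices. -/
def oprod {I : Type*} [LinearOrder I] {W : Type*} [Monoid W] (A : Finset I) (γ : I → W) : W :=
  ((A.sort (· ≤ ·)).map γ).prod

/-- The interval `[r] = {k | r₁ ≤ k ≤ r₂}` as a finite set. -/
def ivl {I : Type*} [Fintype I] [LinearOrder I] (r : I × I) : Finset I :=
  Finset.univ.filter (fun k => r.1 ≤ k ∧ k ≤ r.2)

/-- `Γ(s,v)`: galleries for `s` whose ordered products over each interval `[r]`, `r ∈ R`,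
equal `v r`. -/
def GammaSV {I : Type*} [Fintype I] [LinearOrder I] {W : Type*} [Group W]
    (s : I → W) (R : Set (I × I)) (v : I × I → W) : Set (I → W) :=
  {γ | (∀ i, γ i = 1 ∨ γ i = s i) ∧ ∀ r ∈ R, oprod (ivl r) γ = v r}

/-- `v^i = v_{f¹} ⋯ v_{f^m}` where `m` is the largest index with `(f^m)₂ < i`. -/
def vup {I : Type*} [LinearOrder I] {W : Type*} [Group W]
    {𝔫 : ℕ} (f : Fin 𝔫 → I × I) (v : I × I → W) (i : I) : W :=
  (((List.finRange 𝔫).filter (fun m => decide ((f m).2 < i))).map (fun m => v (f m))).prod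

/-- The set `I^F = I ∖ ⋃_{f∈F} [f]`. -/
def IFset {I : Type*} [LinearOrder I] {𝔫 : ℕ} (f : Fin 𝔫 → I × I) : Set I :=
  {i | ∀ m, i ∉ Set.Icc (f m).1 (f m).2}

open Classical in
/-- Extension by `1` of a function defined on a subset `J ⊆ I`. -/
noncomputable def extFn {I : Type*} {W : Type*} [One W] {J : Set I} (δ : J → W) : I → W :=
  fun i => if h : i ∈ J then δ ⟨i, h⟩ else 1

theorem oprod_congr {I : Type*} [LinearOrder I] {W : Type*} [Monoid W] {A : Finset I}
    {γ δ : I → W} (h : ∀ i ∈ A, γ i = δ i) : oprod A γ = oprod A δ := by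
  unfold oprod
  congr 1
  exact List.map_congr_left fun i hi => h i (by simpa using hi)

theorem mem_ivl {I : Type*} [Fintype I] [LinearOrder I] {r : I × I} {i : I} :
    i ∈ ivl r ↔ i ∈ Set.Icc r.1 r.2 := by
  simp [ivl]

theorem extFn_of_mem {I : Type*} {W : Type*} [One W] {J : Set I} (δ : J → W) {i : I}
    (h : i ∈ J) : extFn δ i = δ ⟨i, h⟩ :=
  dif_pos h

/-- In a finite family of intervals, each interval is contained in a maximal one. -/
theorem exists_maximal_interval {I : Type*} [Finite I] [LinearOrder I] (R : Set (I × I))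
    {r : I × I} (hr : r ∈ R) :
    ∃ t ∈ R, Set.Icc r.1 r.2 ⊆ Set.Icc t.1 t.2 ∧ ∀ r' ∈ R,
      Set.Icc t.1 t.2 ⊆ Set.Icc r'.1 r'.2 → Set.Icc r'.1 r'.2 ⊆ Set.Icc t.1 t.2 := by
  obtain ⟨_, hle, ⟨t, ht, rfl⟩, hmax⟩ :=
    ((Set.toFinite R).image fun r : I × I => Set.Icc r.1 r.2).exists_le_maximal
      (Set.mem_image_of_mem _ hr)
  exact ⟨t, ht, hle, fun r' hr' h => hmax (Set.mem_image_of_mem _ hr') h⟩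

theorem eq_of_mem_Icc_of_ordered {I : Type*} [LinearOrder I] {n : ℕ} {f : Fin n → I × I}
    (horder : ∀ m m' : Fin n, m < m' → (f m).2 < (f m').1) {m m' : Fin n} {i : I}
    (h : i ∈ Set.Icc (f m).1 (f m).2) (h' : i ∈ Set.Icc (f m').1 (f m').2) : m = m' := by
  rcases lt_trichotomy m m' with hlt | heq | hlt
  · exact absurd ((h'.1.trans h.2).trans_lt (horder _ _ hlt)) (lt_irrefl _)
  · exact heq
  · exact absurd ((h.1.trans h'.2).trans_lt (horder _ _ hlt)) (lt_irrefl _)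

/-- Assume `R` is nonempty.  Then the map
`γ ↦ (p^F_K(γ), γ|_{[f¹]}, …, γ|_{[f^𝔫]})` is a bijection from `Γ(s,v)` onto the product
`Γ(s^F) × Γ(s_{f¹}, v_{f¹}) × ⋯ × Γ(s_{f^𝔫}, v_{f^𝔫})`. -/
theorem statement11 {I : Type*} [Fintype I] [LinearOrder I] {W : Type*} [Group W]
    (s : I → W) (hs : ∀ i, s i * s i = 1)
    (R : Set (I × I)) (hR : NestedOn Set.univ R) (hRne : R.Nonempty)
    (v : I × I → W)
    {𝔫 : ℕ} (f : Fin 𝔫 → I × I)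
    (hmax : ∀ m, f m ∈ R ∧ ∀ r ∈ R,
      Set.Icc (f m).1 (f m).2 ⊆ Set.Icc r.1 r.2 → Set.Icc r.1 r.2 ⊆ Set.Icc (f m).1 (f m).2)
    (hall : ∀ r ∈ R, (∀ r' ∈ R,
      Set.Icc r.1 r.2 ⊆ Set.Icc r'.1 r'.2 → Set.Icc r'.1 r'.2 ⊆ Set.Icc r.1 r.2) →
      ∃ m, f m = r)
    (horder : ∀ m m' : Fin 𝔫, m < m' → (f m).2 < (f m').1) :
    Set.BijOn
      (fun γ : I → W =>
        ((fun i : IFset f => vup f v i.1 * γ i.1 * (vup f v i.1)⁻¹,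
          fun (m : Fin 𝔫) (j : Set.Icc (f m).1 (f m).2) => γ j.1) :
          ((IFset f → W) × ((m : Fin 𝔫) → Set.Icc (f m).1 (f m).2 → W))))
      (GammaSV s R v)
      {q : (IFset f → W) × ((m : Fin 𝔫) → Set.Icc (f m).1 (f m).2 → W) |
        (∀ i : IFset f, q.1 i = 1 ∨ q.1 i = vup f v i.1 * s i.1 * (vup f v i.1)⁻¹) ∧
        ∀ m : Fin 𝔫,
          (∀ j : Set.Icc (f m).1 (f m).2, q.2 m j = 1 ∨ q.2 m j = s j.1) ∧
          ∀ r ∈ R, Set.Icc r.1 r.2 ⊆ Set.Icc (f m).1 (f m).2 →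
            oprod (ivl r) (extFn (q.2 m)) = v r} := by
  classical
  refine ⟨?_, ?_, ?_⟩
  · rintro γ ⟨hγ, hv⟩
    refine ⟨fun i => ?_, fun m => ⟨fun j => hγ j, fun r hr hsub => ?_⟩⟩
    · rcases hγ i with h | h
      · left; simp [h]
      · right; simp [h]
    · rw [← hv r hr]
      exact oprod_congr fun i hi => extFn_of_mem _ (hsub (mem_ivl.1 hi))
  · intro γ _ δ _ h
    obtain ⟨h₁, h₂⟩ := Prod.ext_iff.1 h
    funext i
    by_cases hi : ∃ m, i ∈ Set.Icc (f m).1 (f m).2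
    · obtain ⟨m, hm⟩ := hi
      exact congrFun (congrFun h₂ m) ⟨i, hm⟩
    · have := congrFun h₁ ⟨i, not_exists.1 hi⟩
      simpa using this
  · rintro ⟨δ, ε⟩ ⟨hδ, hε⟩
    let γ : I → W := fun i =>
      if h : ∃ m, i ∈ Set.Icc (f m).1 (f m).2 then extFn (ε h.choose) i
      else (vup f v i)⁻¹ * extFn δ i * vup f v i
    have hin (m : Fin 𝔫) (i : I) (hi : i ∈ Set.Icc (f m).1 (f m).2) :
        γ i = extFn (ε m) i := by
      have h : ∃ m, i ∈ Set.Icc (f m).1 (f m).2 := ⟨m, hi⟩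
      simp only [γ, dif_pos h]
      rw [eq_of_mem_Icc_of_ordered horder h.choose_spec hi]
    have hout (i : IFset f) : γ i = (vup f v i)⁻¹ * δ i * vup f v i := by
      simp only [γ, dif_neg (not_exists.2 i.2), extFn_of_mem δ i.2]
    refine ⟨γ, ⟨fun i => ?_, fun r hr => ?_⟩, ?_⟩
    · by_cases hi : ∃ m, i ∈ Set.Icc (f m).1 (f m).2
      · obtain ⟨m, hm⟩ := hi
        rw [hin m i hm, extFn_of_mem _ hm]
        exact (hε m).1 ⟨i, hm⟩
      · have hγ := hout ⟨i, not_exists.1 hi⟩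
        rw [hγ]
        rcases hδ ⟨i, not_exists.1 hi⟩ with h | h <;> dsimp only at h <;> rw [h]
        · left; group
        · right; group
    · obtain ⟨t, ht, hrt, htmax⟩ := exists_maximal_interval R hr
      obtain ⟨m, rfl⟩ := hall t ht htmax
      rw [← (hε m).2 r hr hrt]
      exact oprod_congr fun i hi => hin m i (hrt (mem_ivl.1 hi))
    · refine Prod.ext (funext fun i => ?_) (funext fun m => funext fun j => ?_)
      · dsimp only
        rw [hout i]
        group
      · exact (hin m j j.2).trans (extFn_of_mem _ j.2)
end

section
/- Assume R is nonempty. Then for every γ ∈ Γ(s,v) and every m ∈ {1,…,𝔫}, the product of p^F_K(γ)_i over all i ∈ I^F with i < f^m₁, taken in increasing order, equals (∏_{i ∈ I, i < f^m₁} γ_i) · (v_{f¹}·v_{f²}⋯v_{f^{m−1}})⁻¹, where the first product is also taken in increasing order of indices. -/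
theorem oprod_union_of_lt {I : Type*} [LinearOrder I] {W : Type*} [Monoid W] {A B : Finset I}
    (h : ∀ a ∈ A, ∀ b ∈ B, a < b) (γ : I → W) :
    oprod (A ∪ B) γ = oprod A γ * oprod B γ := by
  have key : (A ∪ B).sort (· ≤ ·) = A.sort (· ≤ ·) ++ B.sort (· ≤ ·) := by
    refine (Finset.sortedLT_sort _).eq_of_mem_iff (List.Pairwise.sortedLT ?_) (by simp)
    rw [List.pairwise_append]
    exact ⟨(Finset.sortedLT_sort A).pairwise, (Finset.sortedLT_sort B).pairwise,
      fun a ha b hb => h a (by simpa using ha) b (by simpa using hb)⟩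
  simp [oprod, key]

theorem oprod_singleton {I : Type*} [LinearOrder I] {W : Type*} [Monoid W] (a : I) (γ : I → W) :
    oprod {a} γ = γ a := by
  simp [oprod]

theorem oprod_empty {I : Type*} [LinearOrder I] {W : Type*} [Monoid W] (γ : I → W) :
    oprod ∅ γ = 1 := by
  simp [oprod]

theorem prod_map_filter_finRange {n : ℕ} {W : Type*} [Monoid W] (p : Fin n → Prop)
    [DecidablePred p] (g : Fin n → W) :
    (((List.finRange n).filter (fun m => decide (p m))).map g).prod =
      oprod (Finset.univ.filter p) g := by
  have key : (List.finRange n).filter (fun m => decide (p m)) =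
      (Finset.univ.filter p).sort (· ≤ ·) :=
    ((List.pairwise_lt_finRange n).filter _).sortedLT.eq_of_mem_iff
      (Finset.sortedLT_sort _) (by simp)
  rw [oprod, key]

/-- For an initial segment `A` that cuts none of the intervals `[f m]`, the twisted product over
the part of `A` outside the intervals, times the product of the `v (f m)` for the intervals
inside `A`, is the product of `γ` over `A`. -/
theorem oprod_conj_mul_oprod {I : Type*} [Fintype I] [LinearOrder I] {W : Type*} [Group W]
    (v : I × I → W) {n : ℕ} (f : Fin n → I × I) (hle : ∀ m, (f m).1 ≤ (f m).2)
    (horder : ∀ m m' : Fin n, m < m' → (f m).2 < (f m').1)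
    (γ : I → W) (hγ : ∀ m, oprod (ivl (f m)) γ = v (f m)) (A : Finset I)
    (hlow : ∀ a ∈ A, ∀ b ≤ a, b ∈ A) (hA : ∀ m, (f m).1 ∈ A → (f m).2 ∈ A) :
    oprod (A.filter (fun i => ∀ m, ¬((f m).1 ≤ i ∧ i ≤ (f m).2)))
        (fun i => vup f v i * γ i * (vup f v i)⁻¹) *
      oprod (Finset.univ.filter (fun m => (f m).2 ∈ A)) (fun m => v (f m)) = oprod A γ := by
  induction A using Finset.strongInduction with
  | H A ih =>
  rcases A.eq_empty_or_nonempty with rfl | hne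
  · simp [oprod_empty]
  set a := A.max' hne with ha
  have haA : a ∈ A := A.max'_mem hne
  have hmax : ∀ b ∈ A, b ≤ a := fun b hb => A.le_max' b hb
  clear_value a
  by_cases hout : ∀ m, ¬((f m).1 ≤ a ∧ a ≤ (f m).2)
  · have hne2 : ∀ m, (f m).2 ≠ a := fun m h => hout m ⟨h ▸ hle m, h.ge⟩
    have hunion : A = A.erase a ∪ {a} := by
      ext i; simp only [Finset.mem_union, Finset.mem_erase, Finset.mem_singleton]
      grind
    have hlt : ∀ b ∈ A.erase a, ∀ c ∈ ({a} : Finset I), b < c := by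
      intro b hb c hc
      rw [Finset.mem_erase] at hb
      rw [Finset.mem_singleton] at hc
      exact hc ▸ lt_of_le_of_ne (hmax b hb.2) hb.1
    have hi := ih (A.erase a) (Finset.erase_ssubset haA)
      (by
        intro b hb c hc
        rw [Finset.mem_erase] at hb ⊢
        refine ⟨?_, hlow b hb.2 c hc⟩
        rintro rfl
        exact hb.1 (le_antisymm (hmax b hb.2) hc))
      (fun m hm => Finset.mem_erase.2 ⟨hne2 m, hA m (Finset.mem_of_mem_erase hm)⟩)
    have hV : (Finset.univ.filter (fun m => (f m).2 ∈ A.erase a)) =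
        Finset.univ.filter (fun m => (f m).2 ∈ A) := by
      ext m; simp [hne2 m]
    have hvup : vup f v a =
        oprod (Finset.univ.filter (fun m => (f m).2 ∈ A)) (fun m => v (f m)) := by
      rw [vup, prod_map_filter_finRange (fun m => (f m).2 < a) (fun m => v (f m))]
      congr 1
      ext m
      simp only [Finset.mem_filter, Finset.mem_univ, true_and]
      exact ⟨fun h => hlow a haA _ h.le, fun h => lt_of_le_of_ne (hmax _ h) (hne2 m)⟩
    have hF : A.filter (fun i => ∀ m, ¬((f m).1 ≤ i ∧ i ≤ (f m).2)) =
        (A.erase a).filter (fun i => ∀ m, ¬((f m).1 ≤ i ∧ i ≤ (f m).2)) ∪ {a} := by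
      conv_lhs => rw [hunion]
      rw [Finset.filter_union, Finset.filter_singleton, if_pos hout]
    have hA' : oprod A γ = oprod (A.erase a) γ * γ a := by
      conv_lhs => rw [hunion]
      rw [oprod_union_of_lt hlt, oprod_singleton]
    rw [hV] at hi
    rw [hF, oprod_union_of_lt (fun b hb => hlt b (Finset.mem_of_mem_filter b hb)),
      oprod_singleton, hA', ← hi, hvup]
    group
  · push Not at hout
    obtain ⟨k, hk1, hk2⟩ := hout
    have hak : (f k).2 = a := le_antisymm (hmax _ (hA k (hlow a haA _ hk1))) hk2
    have hmem : ∀ i, i ∈ ivl (f k) ↔ (f k).1 ≤ i ∧ i ≤ (f k).2 := by simp [ivl]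
    have hsd : ∀ i, i ∈ A \ ivl (f k) ↔ i < (f k).1 := by
      intro i
      rw [Finset.mem_sdiff, hmem]
      refine ⟨fun h => ?_, fun h => ⟨hlow a haA _ (h.le.trans hk1), fun h' => h'.1.not_gt h⟩⟩
      by_contra hc
      exact h.2 ⟨not_lt.1 hc, hak ▸ hmax i h.1⟩
    have hunion : A = A \ ivl (f k) ∪ ivl (f k) := by
      refine (Finset.sdiff_union_of_subset fun i hi => ?_).symm
      exact hlow a haA _ (hak ▸ ((hmem i).1 hi).2)
    have hlt : ∀ b ∈ A \ ivl (f k), ∀ c ∈ ivl (f k), b < c := fun b hb c hc =>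
      ((hsd b).1 hb).trans_le ((hmem c).1 hc).1
    have hltk : ∀ m, (f m).2 < (f k).1 ↔ m < k := by
      refine fun m => ⟨fun h => ?_, horder m k⟩
      by_contra hc
      rcases (not_lt.1 hc).eq_or_lt with rfl | h'
      · exact (hle k).not_gt h
      · exact (((hle k).trans_lt (horder k m h')).trans_le (hle m)).not_gt h
    have hi := ih (A \ ivl (f k))
      ((Finset.ssubset_iff_of_subset Finset.sdiff_subset).2
        ⟨a, haA, fun h => ((hsd a).1 h).not_ge hk1⟩)
      (fun b hb c hc => (hsd c).2 (hc.trans_lt ((hsd b).1 hb)))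
      (by
        intro m hm
        rw [hsd] at hm ⊢
        rw [hltk]
        by_contra hc
        rcases (not_lt.1 hc).eq_or_lt with rfl | h'
        · exact hm.false
        · exact ((hle k).trans_lt (horder k m h')).not_gt hm)
    have hV : Finset.univ.filter (fun m => (f m).2 ∈ A) =
        Finset.univ.filter (fun m => (f m).2 ∈ A \ ivl (f k)) ∪ {k} := by
      ext m
      simp only [Finset.mem_filter, Finset.mem_univ, true_and, Finset.mem_union,
        Finset.mem_singleton, hsd, hltk]
      rw [← le_iff_lt_or_eq]
      refine ⟨fun h => ?_, fun h => ?_⟩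
      · by_contra hc
        exact ((horder k m (not_le.1 hc)).trans_le (hle m)).not_ge (hak ▸ hmax _ h)
      · rcases h.eq_or_lt with rfl | h'
        · exact hak ▸ haA
        · exact hlow a haA _ ((horder m k h').le.trans hk1)
    have hF : A.filter (fun i => ∀ m, ¬((f m).1 ≤ i ∧ i ≤ (f m).2)) =
        (A \ ivl (f k)).filter (fun i => ∀ m, ¬((f m).1 ≤ i ∧ i ≤ (f m).2)) := by
      ext i
      simp only [Finset.mem_filter, Finset.mem_sdiff, hmem]
      exact ⟨fun h => ⟨⟨h.1, h.2 k⟩, h.2⟩, fun h => ⟨h.1.1, h.2⟩⟩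
    have hA' : oprod A γ = oprod (A \ ivl (f k)) γ * v (f k) := by
      conv_lhs => rw [hunion]
      rw [oprod_union_of_lt hlt, hγ]
    rw [hF, hV, oprod_union_of_lt, oprod_singleton, hA', ← hi, mul_assoc]
    intro b hb c hc
    rw [Finset.mem_filter, hsd, hltk] at hb
    rw [Finset.mem_singleton] at hc
    exact hc ▸ hb.2

/-- Assume `R` is nonempty.  For every `γ ∈ Γ(s,v)` and every
`m ∈ {1,…,𝔫}`, the ordered product of `p^F_K(γ)ᵢ = vⁱ·γᵢ·(vⁱ)⁻¹` over all `i ∈ I^F` with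
`i < f^m₁` equals `(∏_{i ∈ I, i < f^m₁} γᵢ) · (v_{f¹}⋯v_{f^{m−1}})⁻¹`, both products taken
in increasing order of the indices. -/
theorem statement12 {I : Type*} [Fintype I] [LinearOrder I] {W : Type*} [Group W]
    (s : I → W) (hs : ∀ i, s i * s i = 1)
    (R : Set (I × I)) (hR : NestedOn Set.univ R) (hRne : R.Nonempty)
    (v : I × I → W)
    {𝔫 : ℕ} (f : Fin 𝔫 → I × I)
    (hmax : ∀ m, f m ∈ R ∧ ∀ r ∈ R,
      Set.Icc (f m).1 (f m).2 ⊆ Set.Icc r.1 r.2 → Set.Icc r.1 r.2 ⊆ Set.Icc (f m).1 (f m).2)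
    (hall : ∀ r ∈ R, (∀ r' ∈ R,
      Set.Icc r.1 r.2 ⊆ Set.Icc r'.1 r'.2 → Set.Icc r'.1 r'.2 ⊆ Set.Icc r.1 r.2) →
      ∃ m, f m = r)
    (horder : ∀ m m' : Fin 𝔫, m < m' → (f m).2 < (f m').1)
    (γ : I → W) (hγ : γ ∈ GammaSV s R v) (m : Fin 𝔫) :
    oprod (Finset.univ.filter
        (fun i => (∀ m' : Fin 𝔫, ¬((f m').1 ≤ i ∧ i ≤ (f m').2)) ∧ i < (f m).1))
        (fun i => vup f v i * γ i * (vup f v i)⁻¹) =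
      oprod (Finset.univ.filter (fun i => i < (f m).1)) γ *
        ((((List.finRange 𝔫).filter (fun m' => decide (m' < m))).map
            (fun m' => v (f m'))).prod)⁻¹ := by
  have hle : ∀ m, (f m).1 ≤ (f m).2 := fun m => hR.2.1 _ (hmax m).1
  have hkey := oprod_conj_mul_oprod v f hle horder γ (fun k => hγ.2 _ (hmax k).1)
    (Finset.univ.filter (fun i => i < (f m).1))
    (by
      simp only [Finset.mem_filter, Finset.mem_univ, true_and]
      exact fun a ha b hb => hb.trans_lt ha)
    (by
      simp only [Finset.mem_filter, Finset.mem_univ, true_and]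
      intro k hk
      refine horder k m ?_
      by_contra hc
      rcases (not_lt.1 hc).eq_or_lt with rfl | h'
      · exact hk.false
      · exact ((hle m).trans_lt (horder m k h')).not_gt hk)
  have hV : Finset.univ.filter
        (fun k => (f k).2 ∈ Finset.univ.filter (fun i => i < (f m).1)) =
      Finset.univ.filter (fun k => k < m) := by
    ext k
    simp only [Finset.mem_filter, Finset.mem_univ, true_and]
    refine ⟨fun h => ?_, horder k m⟩
    by_contra hc
    rcases (not_lt.1 hc).eq_or_lt with rfl | h'
    · exact (hle m).not_gt h
    · exact (((hle m).trans_lt (horder m k h')).trans_le (hle k)).not_gt h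
  rw [prod_map_filter_finRange (fun k => k < m) (fun k => v (f k)), eq_mul_inv_iff_mul_eq,
    ← hkey, hV, Finset.filter_filter]
  simp only [and_comm]
end
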